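/- arXiv:2211.10626 — 4 statements merged into one kernel-verified Lean document; each statement's English description precedes it below -/
import Mathlib

section
/- Let P be a dcpo such that for every Scott-closed set A with A ≠ P and every compact saturated subset K of ΣP, the set ↓(K ∩ A) is Scott closed. Then (P, σ(P)) is weak well-filtered. -/
open Set
/-- The Scott topology on a preorder: opens are the upper sets `U` such that every
directed set having a least upper bound in `U` meets `U`. -/
def scottTopology (P : Type*) [Preorder P] : TopologicalSpace P where
  IsOpen U := IsUpperSet U ∧
    ∀ D : Set P, D.Nonempty → DirectedOn (· ≤ ·) D → ∀ a : P, IsLUB D a → a ∈ U →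
      (D ∩ U).Nonempty
  isOpen_univ :=
    ⟨isUpperSet_univ, fun _ hD _ _ _ _ => hD.imp fun _ hd => ⟨hd, trivial⟩⟩
  isOpen_inter U V hU hV := by
    refine ⟨hU.1.inter hV.1, fun D hD hdir a ha haUV => ?_⟩
    obtain ⟨d₁, hd₁D, hd₁U⟩ := hU.2 D hD hdir a ha haUV.1
    obtain ⟨d₂, hd₂D, hd₂V⟩ := hV.2 D hD hdir a ha haUV.2
    obtain ⟨d₃, hd₃D, h₁₃, h₂₃⟩ := hdir d₁ hd₁D d₂ hd₂D
    exact ⟨d₃, hd₃D, hU.1 h₁₃ hd₁U, hV.1 h₂₃ hd₂V⟩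
  isOpen_sUnion S hS := by
    refine ⟨isUpperSet_sUnion fun U hU => (hS U hU).1, fun D hD hdir a ha haS => ?_⟩
    obtain ⟨U, hUS, haU⟩ := haS
    obtain ⟨d, hdD, hdU⟩ := (hS U hUS).2 D hD hdir a ha haU
    exact ⟨d, hdD, U, hUS, hdU⟩

section
attribute [local instance] scottTopology

/-- A topological space is *weak well-filtered* if whenever a nonempty open set `U` contains
the intersection of a (nonempty) filtered family of nonempty compact saturated sets, then `U`
contains some member of the family.  A set is saturated if it equals the intersection of all
open sets containing it. -/
def WeakWellFiltered (X : Type*) [TopologicalSpace X] : Prop :=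
  ∀ 𝒦 : Set (Set X), 𝒦.Nonempty →
    (∀ K ∈ 𝒦, K.Nonempty ∧ IsCompact K ∧ K = ⋂₀ {U : Set X | IsOpen U ∧ K ⊆ U}) →
    (∀ K₁ ∈ 𝒦, ∀ K₂ ∈ 𝒦, ∃ K₃ ∈ 𝒦, K₃ ⊆ K₁ ∩ K₂) →
    ∀ U : Set X, IsOpen U → U.Nonempty → ⋂₀ 𝒦 ⊆ U → ∃ K ∈ 𝒦, K ⊆ U

/-- A Scott-closed set is a lower set. -/
theorem isLowerSet_of_isClosed_scott {P : Type*} [Preorder P] {C : Set P} (hC : IsClosed C) :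
    IsLowerSet C :=
  isUpperSet_compl.1 hC.isOpen_compl.1

/-- A Scott-closed set contains every least upper bound of each of its directed subsets. -/
theorem isLUB_mem_of_isClosed_scott {P : Type*} [Preorder P] {C : Set P} (hC : IsClosed C)
    {D : Set P} (hD : D.Nonempty) (hdir : DirectedOn (· ≤ ·) D) (hDC : D ⊆ C) {a : P}
    (ha : IsLUB D a) : a ∈ C := by
  by_contra haC
  obtain ⟨d, hdD, hdC⟩ := hC.isOpen_compl.2 D hD hdir a ha haC
  exact hdC (hDC hdD)

/-- In a dcpo, every point of a Scott-closed set lies below a maximal point of that set. -/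
theorem exists_le_maximal_of_isClosed_scott {P : Type*} [PartialOrder P]
    (hdcpo : ∀ D : Set P, D.Nonempty → DirectedOn (· ≤ ·) D → ∃ a : P, IsLUB D a)
    {C : Set P} (hC : IsClosed C) {x : P} (hx : x ∈ C) : ∃ m, x ≤ m ∧ Maximal (· ∈ C) m := by
  refine zorn_le_nonempty₀ C (fun c hcC hc y hy => ?_) x hx
  obtain ⟨a, ha⟩ := hdcpo c ⟨y, hy⟩ hc.directedOn
  exact ⟨a, isLUB_mem_of_isClosed_scott hC ⟨y, hy⟩ hc.directedOn hcC ha, fun z hz => ha.1 hz⟩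

/-- Topological Rudin lemma, existence part: a closed set meeting every member of a family of
compact sets contains a minimal such closed set. -/
theorem exists_minimal_isClosed_inter_nonempty {X : Type*} [TopologicalSpace X]
    {𝒦 : Set (Set X)} (h𝒦 : ∀ K ∈ 𝒦, IsCompact K) {A : Set X} (hA : IsClosed A)
    (hmeet : ∀ K ∈ 𝒦, (K ∩ A).Nonempty) :
    ∃ C ⊆ A, Minimal (fun C : Set X => IsClosed C ∧ ∀ K ∈ 𝒦, (K ∩ C).Nonempty) C := by
  refine zorn_superset_nonempty {C : Set X | IsClosed C ∧ ∀ K ∈ 𝒦, (K ∩ C).Nonempty}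
    (fun c hcS hc hne => ⟨⋂₀ c, ⟨isClosed_sInter fun s hs => (hcS hs).1, fun K hK => ?_⟩,
      fun s hs => sInter_subset_of_mem hs⟩) A ⟨hA, hmeet⟩
  have : Nonempty c := hne.to_subtype
  by_contra hempty
  rw [sInter_eq_iInter, not_nonempty_iff_eq_empty] at hempty
  obtain ⟨s, hs⟩ := (h𝒦 K hK).elim_directed_family_closed
    (fun s : c => (s : Set X)) (fun s => (hcS s.2).1) hempty
    (fun s t => (hc.total s.2 t.2).elim (fun hst => ⟨s, subset_rfl, hst⟩)
      fun hts => ⟨t, hts, subset_rfl⟩)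
  exact ((hcS s.2).2 K hK).ne_empty hs

/-- Let `P` be a dcpo such that for every Scott-closed `A ≠ P` and every (nonempty) compact
saturated subset `K` of `ΣP`, the set `↓(K ∩ A)` is Scott closed.  Then `(P, σ(P))` is weak
well-filtered. -/
theorem weakWellFiltered_of_lowerClosure_closed (P : Type*) [PartialOrder P]
    (hdcpo : ∀ D : Set P, D.Nonempty → DirectedOn (· ≤ ·) D → ∃ a : P, IsLUB D a)
    (h : ∀ A : Set P, IsClosed A → A ≠ Set.univ →
      ∀ K : Set P, K.Nonempty → IsCompact K → K = ⋂₀ {U : Set P | IsOpen U ∧ K ⊆ U} →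
        IsClosed {y : P | ∃ b ∈ K ∩ A, y ≤ b}) :
    WeakWellFiltered P := by
  intro 𝒦 h𝒦ne h𝒦 hfil U hU hUne hsub
  by_contra! hnot
  have hmeet : ∀ K ∈ 𝒦, (K ∩ Uᶜ).Nonempty := fun K hK => inter_compl_nonempty_iff.2 (hnot K hK)
  obtain ⟨C, hCU, hC⟩ := exists_minimal_isClosed_inter_nonempty
    (fun K hK => (h𝒦 K hK).2.1) hU.isClosed_compl hmeet
  obtain ⟨hCcl, hCmeet⟩ := hC.prop
  have hCuniv : C ≠ univ := by
    rintro rfl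
    obtain ⟨u, hu⟩ := hUne
    exact hCU (mem_univ u) hu
  have hCle : ∀ K ∈ 𝒦, C ⊆ {y : P | ∃ b ∈ K ∩ C, y ≤ b} := by
    intro K hK
    obtain ⟨hKne, hKc, hKsat⟩ := h𝒦 K hK
    refine hC.le_of_le ⟨h C hCcl hCuniv K hKne hKc hKsat, fun K' hK' => ?_⟩ ?_
    · obtain ⟨K'', hK'', hK''sub⟩ := hfil K hK K' hK'
      obtain ⟨x, hxK, hxC⟩ := hCmeet K'' hK''
      exact ⟨x, (hK''sub hxK).2, x, ⟨(hK''sub hxK).1, hxC⟩, le_rfl⟩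
    · rintro y ⟨b, hb, hyb⟩
      exact isLowerSet_of_isClosed_scott hCcl hyb hb.2
  obtain ⟨K₀, hK₀⟩ := h𝒦ne
  obtain ⟨x, -, hxC⟩ := hCmeet K₀ hK₀
  obtain ⟨m, -, hm⟩ := exists_le_maximal_of_isClosed_scott hdcpo hCcl hxC
  refine hCU hm.prop (hsub fun K hK => ?_)
  obtain ⟨b, hb, hmb⟩ := hCle K hK hm.prop
  exact hm.eq_of_le hb.2 hmb ▸ hb.1

end
end

section
/- The set ℕ of natural numbers with its usual order, endowed with the Scott topology, is a d*-space but is not a d-space. -/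
open Set
/-- The specialization order on a topological space: `x ≤ y` iff `x ∈ closure {y}`. -/
def specLE {X : Type*} [TopologicalSpace X] (x y : X) : Prop := x ∈ closure {y}

/-- The upper closure `↑x = {y | x ≤ y}` of a point in the specialization order. -/
def upSet {X : Type*} [TopologicalSpace X] (x : X) : Set X := {y | specLE x y}

/-- A `T₀` space `X` is a *d\*-space* if for every (nonempty) directed subset `D` of `X`
(in the specialization order), every `x ∈ X` and every nonempty open `U`,
`⋂_{d ∈ D} ↑d ∩ ↑x ⊆ U` implies `↑d ∩ ↑x ⊆ U` for some `d ∈ D`. -/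
def IsDStarSpace (X : Type*) [TopologicalSpace X] : Prop :=
  ∀ D : Set X, D.Nonempty → DirectedOn specLE D → ∀ x : X, ∀ U : Set X,
    IsOpen U → U.Nonempty →
    (⋂ d ∈ D, upSet d) ∩ upSet x ⊆ U → ∃ d ∈ D, upSet d ∩ upSet x ⊆ U
/-- `a` is a least upper bound of `D` for the relation `r`. -/
def IsLUBRel {P : Type*} (r : P → P → Prop) (D : Set P) (a : P) : Prop :=
  (∀ d ∈ D, r d a) ∧ ∀ b : P, (∀ d ∈ D, r d b) → r a b

/-- A `T₀` space is a *d-space* (monotone convergence space) if it is a dcpo in its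
specialization order and every open set is Scott open with respect to the
specialization order. -/
def IsDSpace (X : Type*) [TopologicalSpace X] : Prop :=
  (∀ D : Set X, D.Nonempty → DirectedOn specLE D → ∃ a : X, IsLUBRel specLE D a) ∧
  ∀ U : Set X, IsOpen U →
    (∀ ⦃x y : X⦄, specLE x y → x ∈ U → y ∈ U) ∧
    (∀ D : Set X, D.Nonempty → DirectedOn specLE D → ∀ a : X,
      IsLUBRel specLE D a → a ∈ U → (D ∩ U).Nonempty)

/-- In a preorder, the complement of a principal lower set is Scott open. -/
theorem isOpen_compl_Iic_scottTopology {P : Type*} [Preorder P] (y : P) :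
    @IsOpen P (scottTopology P) (Set.Iic y)ᶜ := by
  refine ⟨fun a b hab ha hb => ha (hab.trans hb), fun D _ _ a ha hay => ?_⟩
  by_contra h
  refine hay (ha.2 fun d hd => ?_)
  by_contra hdy
  exact h ⟨d, hd, hdy⟩

/-- The specialization order of the Scott topology is the original order. -/
theorem specLE_scottTopology_iff {P : Type*} [Preorder P] {x y : P} :
    @specLE P (scottTopology P) x y ↔ x ≤ y := by
  let _ := scottTopology P
  constructor
  · intro h
    have hcl : IsClosed (Set.Iic y) := ⟨isOpen_compl_Iic_scottTopology y⟩
    exact closure_minimal (Set.singleton_subset_iff.2 (Set.mem_Iic.2 le_rfl)) hcl h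
  · intro h
    exact mem_closure_iff.2 fun U hU hx => ⟨y, hU.1 h hx, rfl⟩

/-- `ℕ` with the Scott topology is a d*-space. -/
theorem isDStarSpace_nat_scottTopology : @IsDStarSpace ℕ (scottTopology ℕ) := by
  intro D hD _ x U hU hne hsub
  obtain ⟨u, hu⟩ := hne
  by_cases h : ∃ d ∈ D, u ≤ d
  · obtain ⟨d, hd, hud⟩ := h
    exact ⟨d, hd, fun y hy => hU.1 (hud.trans (specLE_scottTopology_iff.1 hy.1)) hu⟩
  · push Not at h
    have hbdd : BddAbove D := ⟨u, fun d hd => (h d hd).le⟩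
    refine ⟨sSup D, Nat.sSup_mem hD hbdd, fun y hy => hsub ⟨?_, hy.2⟩⟩
    exact Set.mem_iInter₂.2 fun d hd => specLE_scottTopology_iff.2
      ((le_csSup hbdd hd).trans (specLE_scottTopology_iff.1 hy.1))

/-- `ℕ` with the Scott topology is not a d-space, since it has no greatest element. -/
theorem not_isDSpace_nat_scottTopology : ¬ @IsDSpace ℕ (scottTopology ℕ) := by
  intro h
  obtain ⟨a, ha, _⟩ := h.1 Set.univ Set.univ_nonempty fun x _ y _ =>
    ⟨max x y, trivial, specLE_scottTopology_iff.2 (le_max_left x y),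
      specLE_scottTopology_iff.2 (le_max_right x y)⟩
  exact Nat.not_succ_le_self a (specLE_scottTopology_iff.1 (ha (a + 1) trivial))

/-- `ℕ` with its usual order, endowed with the Scott topology, is a d*-space but not a
d-space. -/
theorem nat_scott_isDStarSpace_not_isDSpace :
    @IsDStarSpace ℕ (scottTopology ℕ) ∧ ¬ @IsDSpace ℕ (scottTopology ℕ) :=
  ⟨isDStarSpace_nat_scottTopology, not_isDSpace_nat_scottTopology⟩
end

section
/- The Johnstone dcpo 𝕁 endowed with the Scott topology is not a strong d-space: for instance, ⋂_{n≥2} ↑(1,n) ∩ ↑(2,2) = ∅, yet ↑(1,n) ∩ ↑(2,2) ≠ ∅ for every n ≥ 2. -/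
open Set
/-- The Johnstone order on `𝕁 = ℕ × (ℕ ∪ {∞})`:
`(j, k) ≤ (m, n)` iff (`j = m` and `k ≤ n`) or (`n = ∞` and `k ≤ m`). -/
def jle (p q : ℕ × ℕ∞) : Prop :=
  (p.1 = q.1 ∧ p.2 ≤ q.2) ∨ (q.2 = ⊤ ∧ p.2 ≤ (q.1 : ℕ∞))

/-- The Scott topology attached to a relation `r`: opens are the `r`-upper sets `U` such
that every `r`-directed set having an `r`-least upper bound in `U` meets `U`. -/
def scottTopologyRel {P : Type*} (r : P → P → Prop) : TopologicalSpace P where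
  IsOpen U := (∀ ⦃x y : P⦄, x ∈ U → r x y → y ∈ U) ∧
    ∀ D : Set P, D.Nonempty → DirectedOn r D → ∀ a : P, IsLUBRel r D a → a ∈ U →
      (D ∩ U).Nonempty
  isOpen_univ :=
    ⟨fun _ _ _ _ => trivial, fun _ hD _ _ _ _ => hD.imp fun _ hd => ⟨hd, trivial⟩⟩
  isOpen_inter U V hU hV := by
    refine ⟨fun x y hx hxy => ⟨hU.1 hx.1 hxy, hV.1 hx.2 hxy⟩, fun D hD hdir a ha haUV => ?_⟩
    obtain ⟨d₁, hd₁D, hd₁U⟩ := hU.2 D hD hdir a ha haUV.1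
    obtain ⟨d₂, hd₂D, hd₂V⟩ := hV.2 D hD hdir a ha haUV.2
    obtain ⟨d₃, hd₃D, h₁₃, h₂₃⟩ := hdir d₁ hd₁D d₂ hd₂D
    exact ⟨d₃, hd₃D, hU.1 hd₁U h₁₃, hV.1 hd₂V h₂₃⟩
  isOpen_sUnion S hS := by
    refine ⟨fun x y hx hxy => ?_, fun D hD hdir a ha haS => ?_⟩
    · obtain ⟨U, hUS, hxU⟩ := hx
      exact ⟨U, hUS, (hS U hUS).1 hxU hxy⟩
    · obtain ⟨U, hUS, haU⟩ := haS
      obtain ⟨d, hdD, hdU⟩ := (hS U hUS).2 D hD hdir a ha haU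
      exact ⟨d, hdD, U, hUS, hdU⟩

/-- A `T₀` space `X` is a *strong d-space* if for every (nonempty) directed subset `D` of `X`
(in the specialization order), every `x ∈ X` and every open `U`,
`⋂_{d ∈ D} ↑d ∩ ↑x ⊆ U` implies `↑d ∩ ↑x ⊆ U` for some `d ∈ D`. -/
def IsStrongDSpace (X : Type*) [TopologicalSpace X] : Prop :=
  ∀ D : Set X, D.Nonempty → DirectedOn specLE D → ∀ x : X, ∀ U : Set X,
    IsOpen U →
    (⋂ d ∈ D, upSet d) ∩ upSet x ⊆ U → ∃ d ∈ D, upSet d ∩ upSet x ⊆ U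

theorem jle_refl (p : ℕ × ℕ∞) : jle p p := Or.inl ⟨rfl, le_rfl⟩

theorem jle_trans {p q r : ℕ × ℕ∞} (hpq : jle p q) (hqr : jle q r) : jle p r := by
  rcases hpq with ⟨h₁, h₂⟩ | ⟨h₁, h₂⟩ <;> rcases hqr with ⟨h₃, h₄⟩ | ⟨h₃, h₄⟩
  · exact Or.inl ⟨h₁.trans h₃, h₂.trans h₄⟩
  · exact Or.inr ⟨h₃, h₂.trans h₄⟩
  · exact Or.inr ⟨top_le_iff.mp (h₁ ▸ h₄), h₃ ▸ h₂⟩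
  · rw [h₁] at h₄
    exact absurd (top_le_iff.mp h₄) (ENat.natCast_ne_top _)

/-- For a preorder relation, the specialization order of its Scott topology is the relation
itself. -/
theorem specLE_scottTopologyRel_iff {P : Type*} {r : P → P → Prop} (hrefl : ∀ x, r x x)
    (htrans : ∀ {x y z}, r x y → r y z → r x z) (x y : P) :
    @specLE P (scottTopologyRel r) x y ↔ r x y := by
  let _ := scottTopologyRel r
  change x ∈ closure {y} ↔ r x y
  rw [mem_closure_iff]
  constructor
  · intro h
    by_contra hxy
    have hopen : IsOpen {z | ¬ r z y} := by
      refine ⟨fun a b ha hab hb => ha (htrans hab hb), fun D _ _ a hlub ha => ?_⟩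
      by_contra hD
      exact ha (hlub.2 y fun d hd => by_contra fun hdy => hD ⟨d, hd, hdy⟩)
    obtain ⟨z, hz, rfl⟩ := h _ hopen hxy
    exact hz (hrefl z)
  · intro hxy U hU hxU
    exact ⟨y, hU.1 hxU hxy, rfl⟩

theorem iInter_jle_one_inter_jle_two_eq_empty :
    (⋂ n ∈ {n : ℕ | 2 ≤ n}, {y : ℕ × ℕ∞ | jle (1, (n : ℕ∞)) y}) ∩
        {y : ℕ × ℕ∞ | jle (2, (2 : ℕ∞)) y} = ∅ := by
  refine eq_empty_of_forall_notMem ?_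
  rintro ⟨a, b⟩ ⟨h₁, h₂⟩
  simp only [mem_iInter, mem_ofPred_eq] at h₁
  rcases h₁ (a + 2) (by omega) with ⟨h, _⟩ | ⟨_, h⟩
  · obtain rfl : 1 = a := h
    rcases h₂ with ⟨h, _⟩ | ⟨_, h⟩
    · exact absurd h (by norm_num)
    · exact absurd (Nat.cast_le.mp (show ((2 : ℕ) : ℕ∞) ≤ ((1 : ℕ) : ℕ∞) from h)) (by norm_num)
  · have := Nat.cast_le.mp h
    dsimp only at this
    omega

theorem jle_one_inter_jle_two_nonempty {n : ℕ} (hn : 2 ≤ n) :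
    ({y : ℕ × ℕ∞ | jle (1, (n : ℕ∞)) y} ∩ {y : ℕ × ℕ∞ | jle (2, (2 : ℕ∞)) y}).Nonempty :=
  ⟨(n, ⊤), Or.inr ⟨rfl, le_rfl⟩, Or.inr ⟨rfl, Nat.cast_le.mpr hn⟩⟩

/-- The Johnstone dcpo `𝕁` with the Scott topology is not a strong d-space: indeed
`⋂_{n ≥ 2} ↑(1, n) ∩ ↑(2, 2) = ∅`, yet `↑(1, n) ∩ ↑(2, 2) ≠ ∅` for every `n ≥ 2`. -/
theorem johnstone_not_strongDSpace :
    ¬ @IsStrongDSpace (ℕ × ℕ∞) (scottTopologyRel jle) ∧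
    (⋂ n ∈ {n : ℕ | 2 ≤ n}, {y : ℕ × ℕ∞ | jle (1, (n : ℕ∞)) y}) ∩
        {y : ℕ × ℕ∞ | jle (2, (2 : ℕ∞)) y} = ∅ ∧
    ∀ n : ℕ, 2 ≤ n →
      ({y : ℕ × ℕ∞ | jle (1, (n : ℕ∞)) y} ∩ {y : ℕ × ℕ∞ | jle (2, (2 : ℕ∞)) y}).Nonempty := by
  refine ⟨fun h => ?_, iInter_jle_one_inter_jle_two_eq_empty,
    fun n => jle_one_inter_jle_two_nonempty⟩
  let _ := scottTopologyRel jle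
  have hspec : ∀ x y : ℕ × ℕ∞, specLE x y ↔ jle x y :=
    specLE_scottTopologyRel_iff jle_refl jle_trans
  have hup : ∀ x : ℕ × ℕ∞, upSet x = {y | jle x y} := fun x => Set.ext (hspec x)
  obtain ⟨_, ⟨n, hn, rfl⟩, hsub⟩ := h ((fun n : ℕ => (1, (n : ℕ∞))) '' {n | 2 ≤ n})
    ⟨_, 2, le_refl 2, rfl⟩ (by
      rintro _ ⟨m, hm, rfl⟩ _ ⟨n, -, rfl⟩
      exact ⟨_, ⟨max m n, le_trans (b := m) hm (le_max_left m n), rfl⟩,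
        (hspec _ _).mpr (Or.inl ⟨rfl, Nat.cast_le.mpr (le_max_left m n)⟩),
        (hspec _ _).mpr (Or.inl ⟨rfl, Nat.cast_le.mpr (le_max_right m n)⟩)⟩)
    (2, 2) ∅ isOpen_empty (by
      simp only [biInter_image, hup]
      exact iInter_jle_one_inter_jle_two_eq_empty.subset)
  rw [hup, hup] at hsub
  obtain ⟨y, hy⟩ := jle_one_inter_jle_two_nonempty hn
  exact hsub hy
end

section
/- If A is a closed subspace of a d*-space X (with the subspace topology), then A is a d*-space. -/
open Set
/-- The specialization order of a subspace is the restriction of that of the ambient space. -/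
theorem specLE_coe_iff {X : Type*} [TopologicalSpace X] {A : Set X} {a b : A} :
    specLE (a : X) (b : X) ↔ specLE a b := by
  simp [specLE, closure_subtype]

/-- If `A` is a closed subspace of a d*-space `X`, then `A` with the subspace topology is a
d*-space. -/
theorem isDStarSpace_closed_subspace (X : Type*) [TopologicalSpace X] [T0Space X]
    (hX : IsDStarSpace X) (A : Set X) (hA : IsClosed A) :
    IsDStarSpace A := by
  intro D hDne hD x U hU hUne hsub
  obtain ⟨W, hW, rfl⟩ := isOpen_induced_iff.1 hU
  have hdir : DirectedOn specLE ((↑) '' D : Set X) := by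
    rintro _ ⟨a, ha, rfl⟩ _ ⟨b, hb, rfl⟩
    obtain ⟨c, hc, hac, hbc⟩ := hD a ha b hb
    exact ⟨c, ⟨c, hc, rfl⟩, specLE_coe_iff.2 hac, specLE_coe_iff.2 hbc⟩
  obtain ⟨u, hu⟩ := hUne
  obtain ⟨_, ⟨d, hd, rfl⟩, hdU⟩ := hX _ (hDne.image _) hdir x (W ∪ Aᶜ)
    (hW.union hA.isOpen_compl) ⟨u, Or.inl hu⟩ (by
      rintro y ⟨hyD, hyx⟩
      by_cases hy : y ∈ A
      · refine Or.inl (hsub (a := ⟨y, hy⟩) ⟨mem_iInter₂.2 fun d hd => ?_, ?_⟩)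
        · exact specLE_coe_iff.1 (mem_iInter₂.1 hyD d ⟨d, hd, rfl⟩)
        · exact specLE_coe_iff.1 hyx
      · exact Or.inr hy)
  refine ⟨d, hd, fun y ⟨hyd, hyx⟩ => ?_⟩
  exact (hdU ⟨specLE_coe_iff.2 hyd, specLE_coe_iff.2 hyx⟩).resolve_right (not_not.2 y.2)
end
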